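/- Let Q be a finite acyclic quiver, a a sink, k = 𝔽_q, M a representation of Q with dims 𝐝^ν, and 𝐝 a filtration of dim M. Then #Fl_Q(𝐝, M) ≡ #Fl_{σ_a Q}(S_a⁺ 𝐝, S_a⁺ M) (mod q), and Fl_Q(𝐝, M) is empty if and only if Fl_{σ_a Q}(S_a⁺𝐝, S_a⁺M) is empty. Here S_a⁺𝐝 is the reflected filtration given by (S_a⁺𝐝)^i = σ_a(𝐝^i) + r_+^i ε_a with r_+^0 = 0 and r_+^i = max{0, (σ_a(𝐝^{i−1} − 𝐝^i))_a + r_+^{i−1}} for 0 < i < ν. -/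

import Mathlib

open Module Finset

noncomputable section

variable (k : Type) [Field k]
variable {Q₀ Q₁ : Type} [Fintype Q₀] [Fintype Q₁] [DecidableEq Q₀] (s t : Q₁ → Q₀)
variable (Mv : Q₀ → Type) [∀ i, AddCommGroup (Mv i)] [∀ i, Module k (Mv i)]
  [∀ i, FiniteDimensional k (Mv i)]
variable (φ : ∀ e : Q₁, Mv (s e) →ₗ[k] Mv (t e))
variable (a : Q₀)

/-- The image of `Φ_a : ⊕_{α : j → a} U_j → M_a` for a family of graded subspaces `U`. -/
def ImaOf (Uv : ∀ i, Submodule k (Mv i)) : Submodule k (Mv a) :=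
  ⨆ e : {e : Q₁ // t e = a},
    Submodule.span k {z : Mv a | ∃ x ∈ Uv (s e.1), z = e.2 ▸ (φ e.1 x)}

/-- `U` is a subrepresentation of `M`. -/
def IsSubrepM (Uv : ∀ i, Submodule k (Mv i)) : Prop :=
  ∀ e : Q₁, ∀ x ∈ Uv (s e), φ e x ∈ Uv (t e)

/-- `U` is a flag of subrepresentations of `M` of type `𝐝`. -/
def IsFlagM (ν : ℕ) (dd : ℕ → Q₀ → ℕ)
    (U : Fin (ν + 1) → ∀ i, Submodule k (Mv i)) : Prop :=
  (∀ (j : Fin ν) (i : Q₀), U j.castSucc i ≤ U j.succ i) ∧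
  (∀ i, U 0 i = ⊥) ∧ (∀ i, U (Fin.last ν) i = ⊤) ∧
  (∀ (j : Fin (ν + 1)) (i : Q₀), finrank k (U j i) = dd j.val i) ∧
  (∀ j, IsSubrepM k s t Mv φ (U j))

variable (W : Type) [AddCommGroup W] [Module k W] [FiniteDimensional k W]
variable (ρ : ∀ e : Q₁, t e = a → (W →ₗ[k] Mv (s e)))

/-- A subrepresentation `(V, T)` of the reflected representation `S_a⁺M` of `σ_a Q`. -/
def IsReflSubrep (V : ∀ i, Submodule k (Mv i)) (T : Submodule k W) : Prop :=
  (∀ e : Q₁, t e ≠ a → ∀ x ∈ V (s e), φ e x ∈ V (t e)) ∧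
  (∀ (e : Q₁) (h : t e = a), ∀ w ∈ T, ρ e h w ∈ V (s e))

/-- A flag of subrepresentations of the reflected representation `S_a⁺M`, with dimension
vectors given by `dd` away from `a` and by `da` at the reflected vertex `a`. -/
def IsReflFlag (ν : ℕ) (dd : ℕ → Q₀ → ℕ) (da : ℕ → ℤ)
    (VT : Fin (ν + 1) → (∀ i, Submodule k (Mv i)) × Submodule k W) : Prop :=
  (∀ (j : Fin ν) (i : Q₀), (VT j.castSucc).1 i ≤ (VT j.succ).1 i) ∧
  (∀ j : Fin ν, (VT j.castSucc).2 ≤ (VT j.succ).2) ∧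
  (∀ j, (VT j).1 a = ⊥) ∧
  (∀ i, (VT 0).1 i = ⊥) ∧ ((VT 0).2 = ⊥) ∧
  (∀ i, i ≠ a → (VT (Fin.last ν)).1 i = ⊤) ∧ ((VT (Fin.last ν)).2 = ⊤) ∧
  (∀ (j : Fin (ν + 1)) (i : Q₀), i ≠ a → finrank k ((VT j).1 i) = dd j.val i) ∧
  (∀ j : Fin (ν + 1), (finrank k ((VT j).2) : ℤ) = da j.val) ∧
  (∀ j, IsReflSubrep k s t Mv φ a W ρ ((VT j).1) ((VT j).2))


theorem aux_card_fib {α β : Type} [Finite α] [Fintype α] [Finite β] (R : α → β → Prop) :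
    Nat.card {p : α × β // R p.1 p.2} = ∑ x : α, Nat.card {b : β // R x b} := by
  rw [Nat.card_congr (Equiv.subtypeProdEquivSigmaSubtype R), Nat.card_sigma]

theorem aux_finite_submodule (k : Type) [Field k] [Finite k] (V : Type) [AddCommGroup V]
    [Module k V] [FiniteDimensional k V] : Finite (Submodule k V) := by
  have : Finite V := Module.finite_of_finite k
  exact Finite.of_injective (fun U : Submodule k V => (U : Set V)) SetLike.coe_injective

theorem aux_indep_fib (k : Type) [Field k] (V : Type) [AddCommGroup V]
    [Module k V] [FiniteDimensional k V] (r : ℕ) (U : Submodule k V) (hU : finrank k U = r) :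
    Nat.card {v : Fin r → V // LinearIndependent k v ∧ Submodule.span k (Set.range v) = U} =
      Nat.card {v : Fin r → U // LinearIndependent k v} := by
  refine Nat.card_congr ⟨fun v => ⟨fun i => ⟨v.1 i, ?_⟩, ?_⟩,
    fun v => ⟨fun i => (v.1 i : V), ?_, ?_⟩, ?_, ?_⟩
  · have h : v.1 i ∈ Submodule.span k (Set.range v.1) := Submodule.subset_span ⟨i, rfl⟩
    exact v.2.2.le h
  · exact LinearIndependent.of_comp U.subtype v.2.1
  · exact v.2.map' U.subtype U.ker_subtype
  · apply Submodule.eq_of_le_of_finrank_eq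
    · rw [Submodule.span_le]; rintro _ ⟨i, rfl⟩; exact (v.1 i).2
    · have := finrank_span_eq_card (v.2.map' U.subtype U.ker_subtype)
      rw [Fintype.card_fin] at this
      rw [hU]; exact this
  · intro v; rfl
  · intro v; rfl

theorem aux_card_grass_mul (k : Type) [Field k] [Fintype k] (V : Type) [AddCommGroup V]
    [Module k V] [FiniteDimensional k V] (r : ℕ) (hr : r ≤ finrank k V) :
    Nat.card {U : Submodule k V // finrank k U = r} *
      ∏ i : Fin r, (Fintype.card k ^ r - Fintype.card k ^ i.val) =
      ∏ i : Fin r, (Fintype.card k ^ finrank k V - Fintype.card k ^ i.val) := by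
  classical
  have : Finite V := Module.finite_of_finite k
  have := aux_finite_submodule k V
  have := Fintype.ofFinite (Submodule k V)
  have := Fintype.ofFinite {U : Submodule k V // finrank k U = r}
  rw [← card_linearIndependent (K := k) (V := V) hr]
  have e : {v : Fin r → V // LinearIndependent k v} ≃
      {p : {U : Submodule k V // finrank k U = r} × (Fin r → V) //
        LinearIndependent k p.2 ∧ Submodule.span k (Set.range p.2) = p.1.1} :=
    ⟨fun v => ⟨(⟨Submodule.span k (Set.range v.1), by
        have := finrank_span_eq_card v.2
        rwa [Fintype.card_fin] at this⟩, v.1), v.2, rfl⟩, fun p => ⟨p.1.2, p.2.1⟩, fun v => rfl, by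
      rintro ⟨⟨⟨U, hU⟩, v⟩, h1, h2⟩
      apply Subtype.ext
      refine Prod.ext (Subtype.ext ?_) rfl
      exact h2⟩
  rw [Nat.card_congr e, aux_card_fib (fun (U : {U : Submodule k V // finrank k U = r})
    (v : Fin r → V) => LinearIndependent k v ∧ Submodule.span k (Set.range v) = U.1)]
  rw [Finset.sum_congr rfl (fun U _ => aux_indep_fib k V r U.1 U.2)]
  rw [Finset.sum_congr rfl (fun U _ => by
    have : Finite U.1 := Module.finite_of_finite k
    have := Fintype.ofFinite U.1
    rw [card_linearIndependent (K := k) (V := U.1) U.2.ge, U.2])]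
  rw [Finset.sum_const, Finset.card_univ, Nat.card_eq_fintype_card, smul_eq_mul]

theorem aux_pow_factor (q r n : ℕ) (hr : r ≤ n) :
    ∏ i : Fin r, (q ^ n - q ^ i.val) =
      (∏ i : Fin r, q ^ i.val) * ∏ i : Fin r, (q ^ (n - i.val) - 1) := by
  rw [← Finset.prod_mul_distrib]
  refine Finset.prod_congr rfl (fun i _ => ?_)
  rw [Nat.mul_sub, ← pow_add, mul_one]
  congr 2
  have := i.2
  omega

theorem aux_prod_mod (q r n : ℕ) (hq : 1 ≤ q) (hr : r ≤ n) :
    ((∏ i : Fin r, (q ^ (n - i.val) - 1) : ℕ) : ZMod q) = (-1) ^ r := by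
  rw [Nat.cast_prod]
  rw [Finset.prod_congr rfl (g := fun _ => (-1 : ZMod q))]
  · simp
  · intro i _
    have := i.2
    rw [Nat.cast_sub (Nat.one_le_pow _ _ hq), Nat.cast_pow, ZMod.natCast_self, zero_pow (by omega)]
    simp

theorem aux_card_grass (k : Type) [Field k] [Fintype k] (V : Type) [AddCommGroup V]
    [Module k V] [FiniteDimensional k V] (r : ℕ) (hr : r ≤ finrank k V) :
    (Nat.card {U : Submodule k V // finrank k U = r} : ZMod (Fintype.card k)) = 1 := by
  have hq : 1 ≤ Fintype.card k := Fintype.card_pos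
  have h := aux_card_grass_mul k V r hr
  rw [aux_pow_factor _ _ _ le_rfl, aux_pow_factor _ _ _ hr, mul_left_comm] at h
  have h2 := Nat.eq_of_mul_eq_mul_left (Finset.prod_pos (fun i _ => Nat.pow_pos hq)) h
  have h3 := congrArg (Nat.cast (R := ZMod (Fintype.card k))) h2
  rw [Nat.cast_mul, aux_prod_mod _ _ _ hq le_rfl, aux_prod_mod _ _ _ hq hr] at h3
  have hu : IsUnit ((-1 : ZMod (Fintype.card k)) ^ r) := (isUnit_one.neg).pow r
  exact hu.mul_right_cancel (by rw [h3, one_mul])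

theorem aux_finrank_comap_mkQ (k : Type) [Field k] (V : Type) [AddCommGroup V]
    [Module k V] [FiniteDimensional k V] (A : Submodule k V) (p : Submodule k (V ⧸ A)) :
    finrank k (p.comap A.mkQ) = finrank k p + finrank k A := by
  have h := LinearMap.finrank_range_add_finrank_ker (A.mkQ.domRestrict (p.comap A.mkQ))
  rw [LinearMap.range_domRestrict, Submodule.map_comap_eq_of_surjective A.mkQ_surjective] at h
  rw [← h, LinearMap.ker_domRestrict, Submodule.ker_mkQ]
  congr 1
  exact (LinearEquiv.finrank_eq (Submodule.comapSubtypeEquivOfLe (Submodule.le_comap_mkQ A p)))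

theorem aux_card_ge (k : Type) [Field k] [Fintype k] (V : Type) [AddCommGroup V]
    [Module k V] [FiniteDimensional k V] (A : Submodule k V) (r : ℕ)
    (hA : finrank k A ≤ r) (hr : r ≤ finrank k V) :
    (Nat.card {U : Submodule k V // A ≤ U ∧ finrank k U = r} : ZMod (Fintype.card k)) = 1 := by
  have hd := A.finrank_quotient_add_finrank
  rw [← aux_card_grass k (V ⧸ A) (r - finrank k A) (by omega)]
  congr 1
  refine Nat.card_congr ⟨fun U => ⟨U.1.map A.mkQ, ?_⟩, fun p => ⟨p.1.comap A.mkQ, ?_, ?_⟩, ?_, ?_⟩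
  · have h := aux_finrank_comap_mkQ k V A (U.1.map A.mkQ)
    rw [Submodule.comap_map_mkQ, sup_eq_right.2 U.2.1, U.2.2] at h
    omega
  · exact Submodule.le_comap_mkQ A _
  · rw [aux_finrank_comap_mkQ, p.2]; omega
  · intro U; apply Subtype.ext
    simp [Submodule.comap_map_mkQ, U.2.1]
  · intro U; apply Subtype.ext
    exact Submodule.map_comap_eq_of_surjective A.mkQ_surjective _

theorem aux_card_interval (k : Type) [Field k] [Fintype k] (V : Type) [AddCommGroup V]
    [Module k V] [FiniteDimensional k V] (A B : Submodule k V) (hAB : A ≤ B) (r : ℕ)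
    (hA : finrank k A ≤ r) (hB : r ≤ finrank k B) :
    (Nat.card {U : Submodule k V // A ≤ U ∧ U ≤ B ∧ finrank k U = r} :
      ZMod (Fintype.card k)) = 1 := by
  have hA' : finrank k (A.comap B.subtype) = finrank k A :=
    (LinearEquiv.finrank_eq (Submodule.comapSubtypeEquivOfLe hAB))
  rw [← aux_card_ge k B (A.comap B.subtype) r (by omega) hB]
  congr 1
  refine Nat.card_congr ⟨fun U => ⟨U.1.comap B.subtype, ?_, ?_⟩,
    fun p => ⟨p.1.map B.subtype, ?_, ?_, ?_⟩, ?_, ?_⟩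
  · exact Submodule.comap_mono U.2.1
  · exact (LinearEquiv.finrank_eq (Submodule.comapSubtypeEquivOfLe U.2.2.1)).trans U.2.2.2
  · have := Submodule.map_mono (f := B.subtype) p.2.1
    rwa [Submodule.map_comap_subtype, inf_eq_right.2 hAB] at this
  · exact Submodule.map_subtype_le _ _
  · exact (Submodule.finrank_map_subtype_eq _ _).trans p.2.2
  · intro U; apply Subtype.ext
    simp [Submodule.map_comap_subtype, U.2.2.1]
  · intro U; apply Subtype.ext
    exact Submodule.comap_map_eq_of_injective B.subtype_injective _

/-- Counting chains where every step has `1` continuation modulo `q`. -/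
theorem aux_card_chain (q : ℕ) (X : Type) [Finite X] (x₀ : X) (R : ℕ → X → X → Prop)
    (P : ℕ → X → Prop) (hP0 : P 0 x₀) (n : ℕ)
    (hstep : ∀ j < n, ∀ x y, P j x → R j x y → P (j + 1) y)
    (hcard : ∀ j < n, ∀ x, P j x → (Nat.card {y // R j x y} : ZMod q) = 1) :
    (Nat.card {f : Fin (n + 1) → X // f 0 = x₀ ∧
      ∀ j : Fin n, R j.val (f j.castSucc) (f j.succ)} : ZMod q) = 1 := by
  classical
  induction n with
  | zero =>
    have : Nat.card {f : Fin (0 + 1) → X // f 0 = x₀ ∧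
      ∀ j : Fin 0, R j.val (f j.castSucc) (f j.succ)} = 1 := by
      rw [Nat.card_eq_one_iff_unique]
      refine ⟨⟨fun f g => Subtype.ext (funext fun i => ?_)⟩, ⟨⟨fun _ => x₀, rfl, fun j => j.elim0⟩⟩⟩
      have : i = 0 := by apply Fin.ext; have := i.2; simp
      rw [this, f.2.1, g.2.1]
    rw [this]; simp
  | succ n ih =>
    have ih' := ih (fun j hj => hstep j (by omega)) (fun j hj => hcard j (by omega))
    have := Fintype.ofFinite X
    have hinv : ∀ f : Fin (n + 1) → X, f 0 = x₀ →
        (∀ j : Fin n, R j.val (f j.castSucc) (f j.succ)) → ∀ j : Fin (n + 1), P j.val (f j) := by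
      intro f h0 h j
      induction j using Fin.induction with
      | zero => rw [h0]; exact hP0
      | succ j ihj => exact hstep j.val (by omega) _ _ ihj (h j)
    let e : {f : Fin (n + 1 + 1) → X // f 0 = x₀ ∧
        ∀ j : Fin (n + 1), R j.val (f j.castSucc) (f j.succ)} ≃
      {p : {f : Fin (n + 1) → X // f 0 = x₀ ∧
        ∀ j : Fin n, R j.val (f j.castSucc) (f j.succ)} × X // R n (p.1.1 (Fin.last n)) p.2} :=
      ⟨fun f => ⟨(⟨fun i => f.1 i.castSucc, f.2.1, fun j => f.2.2 j.castSucc⟩,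
          f.1 (Fin.last (n + 1))), f.2.2 (Fin.last n)⟩,
       fun p => ⟨Fin.snoc (α := fun _ => X) p.1.1.1 p.1.2, by
          rw [show (0 : Fin (n + 1 + 1)) = Fin.castSucc 0 from rfl, Fin.snoc_castSucc]
          exact p.1.1.2.1, by
          intro j
          rcases Fin.eq_castSucc_or_eq_last j with ⟨j, rfl⟩ | rfl
          · rw [Fin.snoc_castSucc, Fin.succ_castSucc, Fin.snoc_castSucc]
            exact p.1.1.2.2 j
          · rw [Fin.snoc_castSucc, Fin.succ_last, Fin.snoc_last]
            exact p.2⟩,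
       fun f => by
          apply Subtype.ext
          exact Fin.snoc_init_self f.1,
       fun p => by
          apply Subtype.ext
          refine Prod.ext (Subtype.ext ?_) ?_
          · funext i; simp
          · simp⟩
    rw [Nat.card_congr e, aux_card_fib (fun (f : {f : Fin (n + 1) → X // f 0 = x₀ ∧
        ∀ j : Fin n, R j.val (f j.castSucc) (f j.succ)}) (y : X) => R n (f.1 (Fin.last n)) y),
      Nat.cast_sum]
    have hone : ∀ f : {f : Fin (n + 1) → X // f 0 = x₀ ∧
        ∀ j : Fin n, R j.val (f j.castSucc) (f j.succ)},
        (Nat.card {y : X // R n (f.1 (Fin.last n)) y} : ZMod q) = 1 := fun f =>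
      hcard n (by omega) _ (by simpa using hinv f.1 f.2.1 f.2.2 (Fin.last n))
    rw [Nat.card_eq_fintype_card] at ih'
    rw [Finset.sum_congr rfl (fun f _ => hone f), Finset.sum_const,
      Finset.card_univ, nsmul_eq_mul, mul_one]
    exact ih'

/-- Ascending flags bounded above by `K`. -/
theorem aux_card_asc (k : Type) [Field k] [Fintype k] (V : Type) [AddCommGroup V]
    [Module k V] [FiniteDimensional k V] (ν : ℕ) (K : ℕ → Submodule k V) (δ : ℕ → ℕ)
    (hδ0 : δ 0 = 0) (hδ : ∀ j < ν, δ j ≤ δ (j + 1)) (hK : ∀ j < ν, K j ≤ K (j + 1))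
    (hδK : ∀ j ≤ ν, δ j ≤ finrank k (K j)) :
    (Nat.card {T : Fin (ν + 1) → Submodule k V // (∀ j : Fin ν, T j.castSucc ≤ T j.succ) ∧
      (∀ j, finrank k (T j) = δ j.val) ∧ (∀ j, T j ≤ K j.val)} : ZMod (Fintype.card k)) = 1 := by
  have := aux_finite_submodule k V
  rw [← aux_card_chain (Fintype.card k) (Submodule k V) ⊥
    (fun j x y => x ≤ y ∧ y ≤ K (j + 1) ∧ finrank k y = δ (j + 1))
    (fun j x => x ≤ K j ∧ finrank k x = δ j) ⟨bot_le, by simp [hδ0]⟩ ν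
    (fun j hj x y hx hxy => hxy.2)
    (fun j hj x hx => aux_card_interval k V x (K (j + 1)) (hx.1.trans (hK j hj)) _
      (hx.2 ▸ hδ j hj) (hδK _ hj))]
  congr 1
  refine Nat.card_congr (Equiv.subtypeEquivRight fun T => ?_)
  constructor
  · rintro ⟨h1, h2, h3⟩
    refine ⟨?_, fun j => ⟨h1 j, h3 j.succ, h2 j.succ⟩⟩
    have := h2 0
    rw [Fin.val_zero, hδ0] at this
    exact Submodule.finrank_eq_zero.1 this
  · rintro ⟨h0, h⟩
    refine ⟨fun j => (h j).1, fun j => ?_, fun j => ?_⟩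
    · rcases Fin.eq_zero_or_eq_succ j with rfl | ⟨j, rfl⟩
      · rw [h0]; simp [hδ0]
      · exact (h j).2.2
    · rcases Fin.eq_zero_or_eq_succ j with rfl | ⟨j, rfl⟩
      · rw [h0]; simp
      · exact (h j).2.1

/-- Ascending flags bounded below by `I`. -/
theorem aux_card_desc (k : Type) [Field k] [Fintype k] (V : Type) [AddCommGroup V]
    [Module k V] [FiniteDimensional k V] (ν : ℕ) (I : ℕ → Submodule k V) (δ : ℕ → ℕ)
    (hδν : δ ν = finrank k V) (hδ : ∀ j < ν, δ j ≤ δ (j + 1)) (hI : ∀ j < ν, I j ≤ I (j + 1))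
    (hδI : ∀ j ≤ ν, finrank k (I j) ≤ δ j) :
    (Nat.card {T : Fin (ν + 1) → Submodule k V // (∀ j : Fin ν, T j.castSucc ≤ T j.succ) ∧
      (∀ j, finrank k (T j) = δ j.val) ∧ (∀ j, I j.val ≤ T j)} : ZMod (Fintype.card k)) = 1 := by
  have := aux_finite_submodule k V
  rw [← aux_card_chain (Fintype.card k) (Submodule k V) ⊤
    (fun j x y => I (ν - (j + 1)) ≤ y ∧ y ≤ x ∧ finrank k y = δ (ν - (j + 1)))
    (fun j x => I (ν - j) ≤ x ∧ finrank k x = δ (ν - j)) ⟨le_top, by simp [hδν]⟩ ν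
    (fun j hj x y hx hxy => ⟨hxy.1, hxy.2.2⟩)
    (fun j hj x hx => by
      have e : ν - j = ν - (j + 1) + 1 := by omega
      rw [e] at hx
      exact aux_card_interval k V (I (ν - (j + 1))) x ((hI _ (by omega)).trans hx.1) _
        (hδI _ (by omega)) (hx.2 ▸ hδ _ (by omega)))]
  congr 1
  refine Nat.card_congr (Equiv.subtypeEquiv (Equiv.arrowCongr Fin.revPerm (Equiv.refl _))
    fun T => ?_)
  change _ ↔ (T (Fin.rev 0) = ⊤ ∧ ∀ j : Fin ν, I (ν - (j.val + 1)) ≤ T j.succ.rev ∧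
    T j.succ.rev ≤ T j.castSucc.rev ∧ finrank k (T j.succ.rev) = δ (ν - (j.val + 1)))
  rw [Fin.rev_zero]
  have key : ∀ j : Fin ν, (I (ν - (j.val + 1)) ≤ T j.succ.rev ∧
    T j.succ.rev ≤ T j.castSucc.rev ∧ finrank k (T j.succ.rev) = δ (ν - (j.val + 1))) ↔
    (I (ν - (j.val + 1)) ≤ T j.rev.castSucc ∧
    T j.rev.castSucc ≤ T j.rev.succ ∧ finrank k (T j.rev.castSucc) = δ (ν - (j.val + 1))) := by
    intro j
    rw [Fin.rev_succ, Fin.rev_castSucc]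
  rw [forall_congr' key]
  constructor
  · rintro ⟨h1, h2, h3⟩
    refine ⟨?_, fun j => ⟨?_, h1 j.rev, ?_⟩⟩
    · apply Submodule.eq_top_of_finrank_eq
      rw [h2, Fin.val_last, hδν]
    · have := h3 j.rev.castSucc
      rwa [Fin.val_castSucc, Fin.val_rev] at this
    · have := h2 j.rev.castSucc
      rwa [Fin.val_castSucc, Fin.val_rev] at this
  · rintro ⟨h0, h⟩
    have h' : ∀ j : Fin ν, I j.val ≤ T j.castSucc ∧ T j.castSucc ≤ T j.succ ∧
        finrank k (T j.castSucc) = δ j.val := by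
      intro j
      have := h j.rev
      rw [Fin.rev_rev, Fin.val_rev] at this
      rwa [show ν - (ν - (j.val + 1) + 1) = j.val by have := j.2; omega] at this
    refine ⟨fun j => (h' j).2.1, fun j => ?_, fun j => ?_⟩
    · rcases Fin.eq_castSucc_or_eq_last j with ⟨j, rfl⟩ | rfl
      · exact (h' j).2.2
      · rw [h0]; simp [hδν]
    · rcases Fin.eq_castSucc_or_eq_last j with ⟨j, rfl⟩ | rfl
      · exact (h' j).1
      · rw [h0]; simp

set_option linter.unusedSectionVars false

/-- Transport along an equality of vertices, as a linear map. -/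
def auxCast {i j : Q₀} (h : i = j) : Mv i →ₗ[k] Mv j where
  toFun x := h ▸ x
  map_add' x y := by subst h; rfl
  map_smul' c x := by subst h; rfl

/-- The map `Φ_a`. -/
def auxPhi : (∀ e : {e : Q₁ // t e = a}, Mv (s e.1)) →ₗ[k] Mv a :=
  ∑ e : {e : Q₁ // t e = a}, (auxCast k Mv e.2 ∘ₗ φ e.1) ∘ₗ LinearMap.proj e

/-- The inclusion of the kernel. -/
def auxRho : W →ₗ[k] (∀ e : {e : Q₁ // t e = a}, Mv (s e.1)) :=
  LinearMap.pi fun e => ρ e.1 e.2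

/-- The sum of the components of a graded subspace over the arrows into `a`. -/
def auxPi (V : ∀ i, Submodule k (Mv i)) :
    Submodule k (∀ e : {e : Q₁ // t e = a}, Mv (s e.1)) :=
  Submodule.pi Set.univ fun e => V (s e.1)

/-- The part of a flag away from `a`. -/
def AuxBase (ν : ℕ) (dd : ℕ → Q₀ → ℕ)
    (V : Fin (ν + 1) → ∀ i, Submodule k (Mv i)) : Prop :=
  (∀ (j : Fin ν) (i : Q₀), V j.castSucc i ≤ V j.succ i) ∧
  (∀ j, V j a = ⊥) ∧
  (∀ i, V 0 i = ⊥) ∧ (∀ i, i ≠ a → V (Fin.last ν) i = ⊤) ∧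
  (∀ (j : Fin (ν + 1)) (i : Q₀), i ≠ a → finrank k (V j i) = dd j.val i) ∧
  (∀ j, ∀ e : Q₁, t e ≠ a → ∀ x ∈ V j (s e), φ e x ∈ V j (t e))

/-- The part of a flag at `a`. -/
def AuxFibU (ν : ℕ) (dd : ℕ → Q₀ → ℕ)
    (V : Fin (ν + 1) → ∀ i, Submodule k (Mv i)) (u : Fin (ν + 1) → Submodule k (Mv a)) : Prop :=
  (∀ j : Fin ν, u j.castSucc ≤ u j.succ) ∧
  (∀ j : Fin (ν + 1), finrank k (u j) = dd j.val a) ∧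
  (∀ j, (auxPi k s t Mv a (V j)).map (auxPhi k s t Mv φ a) ≤ u j)

/-- The part of a reflected flag at `a`. -/
def AuxFibT (ν : ℕ) (da : ℕ → ℤ)
    (V : Fin (ν + 1) → ∀ i, Submodule k (Mv i)) (T : Fin (ν + 1) → Submodule k W) : Prop :=
  (∀ j : Fin ν, T j.castSucc ≤ T j.succ) ∧
  (∀ j : Fin (ν + 1), (finrank k (T j) : ℤ) = da j.val) ∧
  (∀ j, T j ≤ (auxPi k s t Mv a (V j)).comap (auxRho k s t Mv a W ρ))

theorem auxPhi_apply (x : ∀ e : {e : Q₁ // t e = a}, Mv (s e.1)) :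
    auxPhi k s t Mv φ a x = ∑ e : {e : Q₁ // t e = a}, (e.2 ▸ (φ e.1 (x e)) : Mv a) := by
  rw [auxPhi, LinearMap.sum_apply]
  rfl

theorem aux_range_eq : ImaOf k s t Mv φ a (fun _ => ⊤) = LinearMap.range (auxPhi k s t Mv φ a) := by
  classical
  apply le_antisymm
  · refine iSup_le fun e => ?_
    rw [Submodule.span_le]
    rintro z ⟨x, -, rfl⟩
    refine ⟨Pi.single e x, ?_⟩
    rw [auxPhi, LinearMap.sum_apply, Finset.sum_eq_single e]
    · simp; rfl
    · intro b _ hb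
      simp [hb]
    · simp
  · rintro _ ⟨x, rfl⟩
    rw [auxPhi_apply]
    refine Submodule.sum_mem _ fun e _ => ?_
    refine Submodule.mem_iSup_of_mem e (Submodule.subset_span ⟨x e, trivial, rfl⟩)

theorem aux_map_le_iff (V : ∀ i, Submodule k (Mv i)) (u : Submodule k (Mv a)) :
    (auxPi k s t Mv a V).map (auxPhi k s t Mv φ a) ≤ u ↔
      ∀ (e : Q₁) (h : t e = a), ∀ x ∈ V (s e), auxCast k Mv h (φ e x) ∈ u := by
  classical
  constructor
  · intro H e h x hx
    apply H
    refine ⟨Pi.single ⟨e, h⟩ x, ?_, ?_⟩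
    · intro b _
      by_cases hb : b = ⟨e, h⟩
      · subst hb; simpa using hx
      · simp [hb]
    · rw [auxPhi, LinearMap.sum_apply, Finset.sum_eq_single ⟨e, h⟩]
      · simp
      · intro b _ hb
        simp [hb]
      · simp
  · rintro H _ ⟨x, hx, rfl⟩
    rw [auxPhi, LinearMap.sum_apply]
    exact Submodule.sum_mem _ fun e _ => H e.1 e.2 _ (hx e trivial)

theorem aux_le_comap_iff (V : ∀ i, Submodule k (Mv i)) (T : Submodule k W) :
    T ≤ (auxPi k s t Mv a V).comap (auxRho k s t Mv a W ρ) ↔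
      ∀ (e : Q₁) (h : t e = a), ∀ w ∈ T, ρ e h w ∈ V (s e) := by
  constructor
  · intro H e h w hw
    exact H hw ⟨e, h⟩ trivial
  · intro H w hw e _
    exact H e.1 e.2 w hw

theorem aux_mem_cast (V : ∀ i, Submodule k (Mv i)) {i j : Q₀} (h : i = j) (x : Mv i) :
    auxCast k Mv h x ∈ V j ↔ x ∈ V i := by
  subst h; rfl

theorem aux_finrank_pi (V : ∀ i, Submodule k (Mv i)) :
    finrank k (auxPi k s t Mv a V) = ∑ e : {e : Q₁ // t e = a}, finrank k (V (s e.1)) := by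
  rw [← Module.finrank_pi_fintype]
  refine LinearEquiv.finrank_eq
    { toFun := fun x e => ⟨x.1 e, x.2 e trivial⟩
      invFun := fun x => ⟨fun e => (x e).1, fun e _ => (x e).2⟩
      map_add' := fun _ _ => rfl
      map_smul' := fun _ _ => rfl
      left_inv := fun _ => rfl
      right_inv := fun _ => rfl }

theorem aux_rank
    (hinj : ∀ w : W, (∀ (e : Q₁) (h : t e = a), ρ e h w = 0) → w = 0)
    (hker : ∀ w : W,
      (∑ e : {e : Q₁ // t e = a}, (e.2 ▸ (φ e.1 (ρ e.1 e.2 w)) : Mv a)) = 0)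
    (hsurjker : ∀ x : ∀ e : {e : Q₁ // t e = a}, Mv (s e.1),
      (∑ e : {e : Q₁ // t e = a}, (e.2 ▸ (φ e.1 (x e)) : Mv a)) = 0 →
      ∃ w : W, ∀ e : {e : Q₁ // t e = a}, ρ e.1 e.2 w = x e)
    (P : Submodule k (∀ e : {e : Q₁ // t e = a}, Mv (s e.1))) :
    finrank k (P.map (auxPhi k s t Mv φ a)) + finrank k (P.comap (auxRho k s t Mv a W ρ)) =
      finrank k P := by
  have hi : Function.Injective (auxRho k s t Mv a W ρ) := by
    rw [← LinearMap.ker_eq_bot, LinearMap.ker_eq_bot']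
    intro w hw
    exact hinj w fun e h => congrFun hw ⟨e, h⟩
  have hr : LinearMap.range (auxRho k s t Mv a W ρ) = LinearMap.ker (auxPhi k s t Mv φ a) := by
    ext x
    rw [LinearMap.mem_ker, auxPhi_apply]
    constructor
    · rintro ⟨w, rfl⟩
      exact hker w
    · intro hx
      obtain ⟨w, hw⟩ := hsurjker x hx
      exact ⟨w, funext hw⟩
  have h := LinearMap.finrank_range_add_finrank_ker ((auxPhi k s t Mv φ a).domRestrict P)
  rw [LinearMap.range_domRestrict, LinearMap.ker_domRestrict] at h
  rw [← h]
  congr 1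
  rw [← LinearMap.finrank_range_of_inj (f := (auxRho k s t Mv a W ρ).domRestrict (P.comap (auxRho k s t Mv a W ρ)))
    (fun x y hxy => Subtype.ext (hi hxy)), LinearMap.range_domRestrict, Submodule.map_comap_eq, hr,
    ← Submodule.finrank_map_subtype_eq P, Submodule.map_comap_subtype, inf_comm]

theorem aux_numeric (ν : ℕ) (x κ S d : ℕ → ℕ) (hx : ∀ n ≤ ν, x n + κ n = S n)
    (hκ : ∀ n < ν, κ n ≤ κ (n + 1)) (rp da : ℕ → ℤ) (hrp0 : rp 0 = 0)
    (hrp : ∀ j, 0 < j → j < ν →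
      rp j = max 0 (((d j : ℤ) - d (j - 1)) + ((S (j - 1) : ℤ) - S j) + rp (j - 1)))
    (hxν : x ν ≤ d ν)
    (hrpν : rp ν = (d ν : ℤ) - x ν) (hda : ∀ j, da j = ((S j : ℤ) - d j) + rp j)
    (hS0 : S 0 = 0) (hd0 : d 0 = 0) :
    ((∀ n ≤ ν, da n ≤ κ n) → ∀ n ≤ ν, x n ≤ d n) ∧
    ((∀ n ≤ ν, x n ≤ d n) → (∀ n ≤ ν, da n ≤ κ n) ∧ (∀ n ≤ ν, 0 ≤ da n) ∧
      (∀ n < ν, da n ≤ da (n + 1))) := by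
  have hpos : ∀ n ≤ ν, 0 ≤ rp n := by
    intro n hn
    rcases Nat.eq_zero_or_pos n with rfl | h0
    · omega
    · rcases hn.eq_or_lt with rfl | h1
      · omega
      · rw [hrp n h0 h1]; exact le_max_left _ _
  constructor
  · intro h n hn
    have := h n hn; have := hpos n hn; have := hx n hn; have := hda n
    omega
  · intro h
    have h1 : ∀ n ≤ ν, rp n ≤ (d n : ℤ) - x n := by
      intro n
      induction n with
      | zero => intro _; have := h 0 (by omega); omega
      | succ n ih =>
        intro hn
        rcases hn.eq_or_lt with h2 | h2
        · rw [h2, hrpν]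
        · have e := hrp (n + 1) (by omega) h2
          rw [Nat.add_sub_cancel] at e
          have := ih (by omega); have := h (n + 1) hn; have := hx n (by omega)
          have := hx (n + 1) hn; have := hκ n (by omega)
          omega
    have h2 : ∀ n ≤ ν, da n ≤ κ n := by
      intro n hn
      have := h1 n hn; have := hx n hn; have := hda n
      omega
    have h3 : ∀ n < ν, da n ≤ da (n + 1) := by
      intro n hn
      rcases (Nat.succ_le_of_lt hn).eq_or_lt with h4 | h4
      · have := h2 n hn.le; have := hκ n hn; have := hx ν le_rfl; have := hda ν
        have h4' : n + 1 = ν := h4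
        subst h4'
        omega
      · have e := hrp (n + 1) (by omega) h4
        rw [Nat.add_sub_cancel] at e
        have := hda n; have := hda (n + 1)
        omega
    refine ⟨h2, ?_, h3⟩
    intro n
    induction n with
    | zero => intro _; have := hda 0; omega
    | succ n ih => intro hn; exact (ih (by omega)).trans (h3 n (by omega))

theorem aux_flag_iff (ν : ℕ) (dd : ℕ → Q₀ → ℕ) (hzero : ∀ i, dd 0 i = 0)
    (hdimM : ∀ i, finrank k (Mv i) = dd ν i) (hsink : ∀ e : Q₁, s e ≠ a)
    (U : Fin (ν + 1) → ∀ i, Submodule k (Mv i)) :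
    IsFlagM k s t Mv φ ν dd U ↔
      AuxBase k s t Mv φ a ν dd (fun j => Function.update (U j) a ⊥) ∧
      AuxFibU k s t Mv φ a ν dd (fun j => Function.update (U j) a ⊥) (fun j => U j a) := by
  have hne : ∀ (j : Fin (ν + 1)) (i : Q₀), i ≠ a → Function.update (U j) a ⊥ i = U j i :=
    fun j i hi => Function.update_of_ne hi _ _
  have heq : ∀ (j : Fin (ν + 1)), Function.update (U j) a ⊥ a = ⊥ :=
    fun j => Function.update_self _ _ _
  obtain ⟨V, hVdef⟩ : ∃ V : Fin (ν + 1) → ∀ i, Submodule k (Mv i),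
      V = fun j => Function.update (U j) a ⊥ := ⟨_, rfl⟩
  rw [← hVdef]
  replace hne : ∀ (j : Fin (ν + 1)) (i : Q₀), i ≠ a → V j i = U j i := by
    intro j i hi; rw [hVdef]; exact hne j i hi
  replace heq : ∀ (j : Fin (ν + 1)), V j a = ⊥ := by
    intro j; rw [hVdef]; exact heq j
  clear hVdef
  constructor
  · rintro ⟨h1, h2, h3, h4, h5⟩
    refine ⟨⟨?_, heq, ?_, ?_, ?_, ?_⟩, ?_, ?_, ?_⟩
    · intro j i
      by_cases hi : i = a
      · subst hi; rw [heq]; exact bot_le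
      · rw [hne _ _ hi, hne _ _ hi]; exact h1 j i
    · intro i
      by_cases hi : i = a
      · subst hi; exact heq _
      · rw [hne _ _ hi]; exact h2 i
    · intro i hi; rw [hne _ _ hi]; exact h3 i
    · intro j i hi; rw [hne _ _ hi]; exact h4 j i
    · intro j e he x hx
      rw [hne _ _ (hsink e)] at hx
      rw [hne _ _ he]; exact h5 j e x hx
    · intro j; exact h1 j a
    · intro j; exact h4 j a
    · intro j
      rw [aux_map_le_iff]
      intro e h x hx
      rw [hne _ _ (hsink e)] at hx
      exact (aux_mem_cast k Mv (U j) h _).2 (h5 j e x hx)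
  · rintro ⟨⟨h1, h2, h3, h4, h5, h6⟩, h7, h8, h9⟩
    refine ⟨?_, ?_, ?_, ?_, ?_⟩
    · intro j i
      by_cases hi : i = a
      · subst hi; exact h7 j
      · have := h1 j i
        rwa [hne _ _ hi, hne _ _ hi] at this
    · intro i
      by_cases hi : i = a
      · subst hi
        have := h8 0
        rw [Fin.val_zero, hzero] at this
        exact Submodule.finrank_eq_zero.1 this
      · have := h3 i
        rwa [hne _ _ hi] at this
    · intro i
      by_cases hi : i = a
      · subst hi
        have := h8 (Fin.last ν)
        rw [Fin.val_last, ← hdimM] at this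
        exact Submodule.eq_top_of_finrank_eq this
      · have := h4 i hi
        rwa [hne _ _ hi] at this
    · intro j i
      by_cases hi : i = a
      · subst hi; exact h8 j
      · have := h5 j i hi
        rwa [hne _ _ hi] at this
    · intro j e x hx
      by_cases he : t e = a
      · have := (aux_map_le_iff k s t Mv φ a _ _).1 (h9 j) e he x (by
          rw [hne _ _ (hsink e)]; exact hx)
        exact (aux_mem_cast k Mv (U j) he _).1 this
      · have := h6 j e he x (by rw [hne _ _ (hsink e)]; exact hx)
        rwa [hne _ _ he] at this

/-- Splitting a flag into its part away from `a` and its part at `a`. -/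
def auxFlagEquiv (ν : ℕ) (dd : ℕ → Q₀ → ℕ) (hzero : ∀ i, dd 0 i = 0)
    (hdimM : ∀ i, finrank k (Mv i) = dd ν i) (hsink : ∀ e : Q₁, s e ≠ a) :
    {U : Fin (ν + 1) → ∀ i, Submodule k (Mv i) // IsFlagM k s t Mv φ ν dd U} ≃
    {p : (Fin (ν + 1) → ∀ i, Submodule k (Mv i)) × (Fin (ν + 1) → Submodule k (Mv a)) //
      AuxBase k s t Mv φ a ν dd p.1 ∧ AuxFibU k s t Mv φ a ν dd p.1 p.2} where
  toFun U := ⟨(fun j => Function.update (U.1 j) a ⊥, fun j => U.1 j a),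
    (aux_flag_iff k s t Mv φ a ν dd hzero hdimM hsink U.1).1 U.2⟩
  invFun p := ⟨fun j => Function.update (p.1.1 j) a (p.1.2 j), by
    rw [aux_flag_iff k s t Mv φ a ν dd hzero hdimM hsink]
    have h1 : (fun j => Function.update (Function.update (p.1.1 j) a (p.1.2 j)) a ⊥) = p.1.1 := by
      funext j
      rw [Function.update_idem, ← p.2.1.2.1 j, Function.update_eq_self]
    have h2 : (fun j => Function.update (p.1.1 j) a (p.1.2 j) a) = p.1.2 := by
      funext j
      rw [Function.update_self]
    rw [h1, h2]
    exact p.2⟩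
  left_inv U := by
    apply Subtype.ext
    funext j
    simp
  right_inv p := by
    apply Subtype.ext
    refine Prod.ext ?_ ?_
    · funext j
      change Function.update (Function.update (p.1.1 j) a (p.1.2 j)) a ⊥ = p.1.1 j
      rw [Function.update_idem, ← p.2.1.2.1 j, Function.update_eq_self]
    · funext j
      change Function.update (p.1.1 j) a (p.1.2 j) a = p.1.2 j
      rw [Function.update_self]

theorem aux_refl_iff (ν : ℕ) (dd : ℕ → Q₀ → ℕ) (da : ℕ → ℤ) (hda0 : da 0 = 0)
    (hdaν : da ν = finrank k W)
    (VT : Fin (ν + 1) → (∀ i, Submodule k (Mv i)) × Submodule k W) :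
    IsReflFlag k s t Mv φ a W ρ ν dd da VT ↔
      AuxBase k s t Mv φ a ν dd (fun j => (VT j).1) ∧
      AuxFibT k s t Mv a W ρ ν da (fun j => (VT j).1) (fun j => (VT j).2) := by
  constructor
  · rintro ⟨h1, h2, h3, h4, h5, h6, h7, h8, h9, h10⟩
    exact ⟨⟨h1, h3, h4, h6, h8, fun j => (h10 j).1⟩, h2, h9, fun j =>
      (aux_le_comap_iff k s t Mv a W ρ _ _).2 (h10 j).2⟩
  · rintro ⟨⟨h1, h3, h4, h6, h8, h11⟩, h2, h9, h12⟩
    refine ⟨h1, h2, h3, h4, ?_, h6, ?_, h8, h9, fun j => ⟨h11 j,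
      (aux_le_comap_iff k s t Mv a W ρ _ _).1 (h12 j)⟩⟩
    · have := h9 0
      rw [Fin.val_zero, hda0] at this
      exact Submodule.finrank_eq_zero.1 (by exact_mod_cast this)
    · have := h9 (Fin.last ν)
      rw [Fin.val_last, hdaν] at this
      exact Submodule.eq_top_of_finrank_eq (by exact_mod_cast this)

theorem aux_fibre [Fintype k]
    (ν : ℕ) (dd : ℕ → Q₀ → ℕ)
    (hzero : ∀ i, dd 0 i = 0) (hmono : ∀ j < ν, ∀ i, dd j i ≤ dd (j + 1) i)
    (hdimM : ∀ i, finrank k (Mv i) = dd ν i)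
    (hsink : ∀ e : Q₁, s e ≠ a)
    (hrank : ∀ P : Submodule k (∀ e : {e : Q₁ // t e = a}, Mv (s e.1)),
      finrank k (P.map (auxPhi k s t Mv φ a)) + finrank k (P.comap (auxRho k s t Mv a W ρ)) =
      finrank k P)
    (rp : ℕ → ℤ) (hrp0 : rp 0 = 0)
    (hrp : ∀ j, 0 < j → j < ν →
      rp j = max 0 (((dd j a : ℤ) - dd (j - 1) a) +
        (∑ e : {e : Q₁ // t e = a}, ((dd (j - 1) (s e.1) : ℤ) - dd j (s e.1))) + rp (j - 1)))
    (hrpν : rp ν = (dd ν a : ℤ) - finrank k (LinearMap.range (auxPhi k s t Mv φ a)))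
    (da : ℕ → ℤ)
    (hda : ∀ j, da j = ((∑ e : {e : Q₁ // t e = a}, (dd j (s e.1) : ℤ)) - dd j a) + rp j)
    (V : Fin (ν + 1) → ∀ i, Submodule k (Mv i)) (hV : AuxBase k s t Mv φ a ν dd V) :
    ((∃ u, AuxFibU k s t Mv φ a ν dd V u) ↔ ∃ T, AuxFibT k s t Mv a W ρ ν da V T) ∧
    (Nat.card {u // AuxFibU k s t Mv φ a ν dd V u} : ZMod (Fintype.card k)) =
      Nat.card {T // AuxFibT k s t Mv a W ρ ν da V T} := by
  obtain ⟨b1, b2, b3, b4, b5, b6⟩ := hV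
  obtain ⟨V', hV'⟩ : ∃ V' : ℕ → ∀ i, Submodule k (Mv i), ∀ j : Fin (ν + 1), V' j.val = V j :=
    ⟨fun n => if h : n < ν + 1 then V ⟨n, h⟩ else fun _ => ⊤, fun j => dif_pos j.2⟩
  have hmonoV : ∀ n < ν, auxPi k s t Mv a (V' n) ≤ auxPi k s t Mv a (V' (n + 1)) := by
    intro n hn
    have e1 := hV' (Fin.castSucc ⟨n, hn⟩)
    have e2 := hV' (Fin.succ ⟨n, hn⟩)
    simp only [Fin.val_castSucc, Fin.val_succ] at e1 e2
    rw [e1, e2]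
    intro x hx e _
    exact b1 ⟨n, hn⟩ _ (hx e trivial)
  have hfr : ∀ n ≤ ν, finrank k (auxPi k s t Mv a (V' n)) =
      ∑ e : {e : Q₁ // t e = a}, dd n (s e.1) := by
    intro n hn
    rw [aux_finrank_pi]
    refine Finset.sum_congr rfl fun e _ => ?_
    have := b5 ⟨n, by omega⟩ (s e.1) (hsink e.1)
    rw [← hV'] at this
    exact this
  have hlast : auxPi k s t Mv a (V' ν) = ⊤ := by
    have e1 := hV' (Fin.last ν)
    rw [Fin.val_last] at e1
    rw [e1, eq_top_iff]
    intro x _ e _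
    change x e ∈ V (Fin.last ν) (s e.1)
    rw [b4 _ (hsink e.1)]
    trivial
  have num := aux_numeric ν
    (fun n => finrank k ((auxPi k s t Mv a (V' n)).map (auxPhi k s t Mv φ a)))
    (fun n => finrank k ((auxPi k s t Mv a (V' n)).comap (auxRho k s t Mv a W ρ)))
    (fun n => ∑ e : {e : Q₁ // t e = a}, dd n (s e.1)) (fun n => dd n a)
    (fun n hn => by rw [← hfr n hn]; exact hrank _)
    (fun n hn => Submodule.finrank_mono (Submodule.comap_mono (hmonoV n hn)))
    rp da hrp0
    (fun j h0 hj => by rw [hrp j h0 hj, Finset.sum_sub_distrib]; push_cast; rfl)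
    (by rw [← hdimM]; exact Submodule.finrank_le _)
    (by rw [hrpν, hlast, Submodule.map_top])
    (fun j => by rw [hda j]; push_cast; rfl)
    (by simp [hzero]) (hzero a)
  obtain ⟨num1, num2⟩ := num
  by_cases c : ∀ n ≤ ν, finrank k ((auxPi k s t Mv a (V' n)).map (auxPhi k s t Mv φ a)) ≤ dd n a
  · obtain ⟨c1, c2, c3⟩ := num2 c
    have hda0 : da 0 = 0 := by rw [hda, hrp0]; simp [hzero]
    have cU := aux_card_desc k (Mv a) ν
      (fun n => (auxPi k s t Mv a (V' n)).map (auxPhi k s t Mv φ a)) (fun n => dd n a)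
      (hdimM a).symm (fun j hj => hmono j hj a) (fun j hj => Submodule.map_mono (hmonoV j hj)) c
    have cT := aux_card_asc k W ν
      (fun n => (auxPi k s t Mv a (V' n)).comap (auxRho k s t Mv a W ρ)) (fun n => (da n).toNat)
      (by simp [hda0]) (fun j hj => Int.toNat_le_toNat (c3 j hj))
      (fun j hj => Submodule.comap_mono (hmonoV j hj))
      (fun j hj => by have := c1 j hj; exact Int.toNat_le.2 this)
    have eU : (Nat.card {u // AuxFibU k s t Mv φ a ν dd V u} : ZMod (Fintype.card k)) = 1 := by
      rw [← cU]
      congr 1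
      refine Nat.card_congr (Equiv.subtypeEquivRight fun u => ?_)
      simp only [hV']
      rfl
    have eT : (Nat.card {T // AuxFibT k s t Mv a W ρ ν da V T} : ZMod (Fintype.card k)) = 1 := by
      rw [← cT]
      congr 1
      refine Nat.card_congr (Equiv.subtypeEquivRight fun T => ?_)
      simp only [hV']
      refine and_congr Iff.rfl (and_congr (forall_congr' fun j => ?_) Iff.rfl)
      have := c2 j.val (by omega)
      omega
    have : Fact (1 < Fintype.card k) := ⟨Fintype.one_lt_card⟩
    refine ⟨⟨fun _ => ?_, fun _ => ?_⟩, by rw [eU, eT]⟩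
    · by_contra hT
      have : IsEmpty {T // AuxFibT k s t Mv a W ρ ν da V T} := ⟨fun T => hT ⟨T.1, T.2⟩⟩
      rw [Nat.card_of_isEmpty] at eT
      simp at eT
    · by_contra hU
      have : IsEmpty {u // AuxFibU k s t Mv φ a ν dd V u} := ⟨fun T => hU ⟨T.1, T.2⟩⟩
      rw [Nat.card_of_isEmpty] at eU
      simp at eU
  · have nU : ¬ ∃ u, AuxFibU k s t Mv φ a ν dd V u := by
      rintro ⟨u, h1, h2, h3⟩
      apply c
      intro n hn
      have e1 := hV' ⟨n, by omega⟩
      have e2 := h2 ⟨n, by omega⟩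
      have e3 := h3 ⟨n, by omega⟩
      rw [← e1] at e3
      simp only at e2
      rw [← e2]
      exact Submodule.finrank_mono e3
    have nT : ¬ ∃ T, AuxFibT k s t Mv a W ρ ν da V T := by
      rintro ⟨u, h1, h2, h3⟩
      apply c
      refine num1 ?_
      intro n hn
      have e1 := hV' ⟨n, by omega⟩
      have e2 := h2 ⟨n, by omega⟩
      have e3 := h3 ⟨n, by omega⟩
      rw [← e1] at e3
      simp only at e2
      rw [← e2]
      exact_mod_cast Submodule.finrank_mono e3
    refine ⟨iff_of_false nU nT, ?_⟩
    have : IsEmpty {T // AuxFibT k s t Mv a W ρ ν da V T} := ⟨fun T => nT ⟨T.1, T.2⟩⟩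
    have : IsEmpty {u // AuxFibU k s t Mv φ a ν dd V u} := ⟨fun T => nU ⟨T.1, T.2⟩⟩
    rw [Nat.card_of_isEmpty, Nat.card_of_isEmpty]

/-- Let `Q` be a finite acyclic quiver, `a` a sink, `k = 𝔽_q`, `M` a
representation of `Q` and `𝐝` a filtration of `dim M`.  Then
`#Fl_Q(𝐝, M) ≡ #Fl_{σ_a Q}(S_a⁺𝐝, S_a⁺M) (mod q)`, and `Fl_Q(𝐝, M)` is empty iff
`Fl_{σ_a Q}(S_a⁺𝐝, S_a⁺M)` is empty.  Here `(S_a⁺𝐝)ʲ = σ_a(𝐝ʲ) + r₊ʲ ε_a` with `r₊⁰ = 0`,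
`r₊ʲ = max {0, (σ_a(𝐝ʲ⁻¹ − 𝐝ʲ))_a + r₊ʲ⁻¹}` for `0 < j < ν`, and
`r₊^ν = s = dim Hom(M, S_a)`. -/
theorem reflection_functor_flag_count_mod_q
    [Fintype k] (q : ℕ) (hq : q = Fintype.card k)
    -- `Q` is acyclic:
    (θ : Q₀ → ℕ) (hacyclic : ∀ e : Q₁, θ (s e) < θ (t e))
    (ν : ℕ) (dd : ℕ → Q₀ → ℕ)
    (hzero : ∀ i, dd 0 i = 0) (hmono : ∀ j < ν, ∀ i, dd j i ≤ dd (j + 1) i)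
    (hdimM : ∀ i, finrank k (Mv i) = dd ν i)
    -- `a` is a sink:
    (hsink : ∀ e : Q₁, s e ≠ a)
    -- `W`, with the maps `ρ`, is the kernel of `Φ_a : ⊕_{α : j → a} M_j → M_a`,
    -- i.e. `(W, ρ) = (S_a⁺M)_a`:
    (hinj : ∀ w : W, (∀ (e : Q₁) (h : t e = a), ρ e h w = 0) → w = 0)
    (hker : ∀ w : W,
      (∑ e : {e : Q₁ // t e = a}, (e.2 ▸ (φ e.1 (ρ e.1 e.2 w)) : Mv a)) = 0)
    (hsurjker : ∀ x : ∀ e : {e : Q₁ // t e = a}, Mv (s e.1),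
      (∑ e : {e : Q₁ // t e = a}, (e.2 ▸ (φ e.1 (x e)) : Mv a)) = 0 →
      ∃ w : W, ∀ e : {e : Q₁ // t e = a}, ρ e.1 e.2 w = x e)
    -- the sequence `r₊` :
    (rp : ℕ → ℤ) (hrp0 : rp 0 = 0)
    (hrp : ∀ j, 0 < j → j < ν →
      rp j = max 0 (((dd j a : ℤ) - dd (j - 1) a) +
        (∑ e : {e : Q₁ // t e = a}, ((dd (j - 1) (s e.1) : ℤ) - dd j (s e.1))) + rp (j - 1)))
    (hrpν : rp ν = finrank k ((Mv a) ⧸ ImaOf k s t Mv φ a (fun _ => ⊤)))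
    -- the reflected filtration `S_a⁺𝐝` at the vertex `a`:
    (da : ℕ → ℤ)
    (hda : ∀ j, da j = ((∑ e : {e : Q₁ // t e = a}, (dd j (s e.1) : ℤ)) - dd j a) + rp j) :
    ((∃ U, IsFlagM k s t Mv φ ν dd U) ↔
      (∃ VT, IsReflFlag k s t Mv φ a W ρ ν dd da VT)) ∧
    Nat.card {U : Fin (ν + 1) → ∀ i, Submodule k (Mv i) // IsFlagM k s t Mv φ ν dd U} % q
      = Nat.card {VT : Fin (ν + 1) → (∀ i, Submodule k (Mv i)) × Submodule k W //
          IsReflFlag k s t Mv φ a W ρ ν dd da VT} % q := by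
  have hrank := aux_rank k s t Mv φ a W ρ hinj hker hsurjker
  have hrpν' : rp ν = (dd ν a : ℤ) - finrank k (LinearMap.range (auxPhi k s t Mv φ a)) := by
    have := Submodule.finrank_quotient_add_finrank (ImaOf k s t Mv φ a (fun _ => ⊤))
    rw [hrpν, ← hdimM a, ← this, aux_range_eq k s t Mv φ a]
    push_cast
    ring
  have hda0 : da 0 = 0 := by rw [hda, hrp0]; simp [hzero]
  have hdaν : da ν = finrank k W := by
    have h := hrank ⊤
    rw [Submodule.map_top, Submodule.comap_top, finrank_top, finrank_top,
      Module.finrank_pi_fintype, Finset.sum_congr rfl (fun e _ => hdimM (s e.1))] at h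
    rw [hda, hrpν', ← Nat.cast_sum, ← h]
    push_cast
    ring
  have hfib := aux_fibre k s t Mv φ a W ρ ν dd hzero hmono hdimM hsink hrank rp hrp0 hrp hrpν' da hda
  have eU := auxFlagEquiv k s t Mv φ a ν dd hzero hdimM hsink
  have eT : {VT : Fin (ν + 1) → (∀ i, Submodule k (Mv i)) × Submodule k W //
          IsReflFlag k s t Mv φ a W ρ ν dd da VT} ≃
      {p : (Fin (ν + 1) → ∀ i, Submodule k (Mv i)) × (Fin (ν + 1) → Submodule k W) //
      AuxBase k s t Mv φ a ν dd p.1 ∧ AuxFibT k s t Mv a W ρ ν da p.1 p.2} :=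
    (Equiv.arrowProdEquivProdArrow _ _ _).subtypeEquiv
      (fun VT => aux_refl_iff k s t Mv φ a W ρ ν dd da hda0 hdaν VT)
  constructor
  · constructor
    · rintro ⟨U, hU⟩
      obtain ⟨p, h1, h2⟩ := eU ⟨U, hU⟩
      obtain ⟨T, hT⟩ := (hfib p.1 h1).1.1 ⟨p.2, h2⟩
      exact ⟨_, (eT.symm ⟨(p.1, T), h1, hT⟩).2⟩
    · rintro ⟨U, hU⟩
      obtain ⟨p, h1, h2⟩ := eT ⟨U, hU⟩
      obtain ⟨T, hT⟩ := (hfib p.1 h1).1.2 ⟨p.2, h2⟩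
      exact ⟨_, (eU.symm ⟨(p.1, T), h1, hT⟩).2⟩
  · have := aux_finite_submodule k W
    have : ∀ i, Finite (Submodule k (Mv i)) := fun i => aux_finite_submodule k (Mv i)
    have := Fintype.ofFinite (Fin (ν + 1) → ∀ i, Submodule k (Mv i))
    subst hq
    refine (ZMod.natCast_eq_natCast_iff' _ _ _).1 ?_
    rw [Nat.card_congr eU, Nat.card_congr eT,
      aux_card_fib (fun (V : Fin (ν + 1) → ∀ i, Submodule k (Mv i)) u =>
        AuxBase k s t Mv φ a ν dd V ∧ AuxFibU k s t Mv φ a ν dd V u),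
      aux_card_fib (fun (V : Fin (ν + 1) → ∀ i, Submodule k (Mv i)) T =>
        AuxBase k s t Mv φ a ν dd V ∧ AuxFibT k s t Mv a W ρ ν da V T), Nat.cast_sum, Nat.cast_sum]
    refine Finset.sum_congr rfl fun V _ => ?_
    by_cases hV : AuxBase k s t Mv φ a ν dd V
    · simp only [hV, true_and]
      exact (hfib V hV).2
    · simp [hV]

end
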